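/- Let F : S → T be a fully faithful exact (triangulated) functor between triangulated categories which admits an exact right adjoint G : T → S. Suppose X_S → Y_S → Z_S → X_S[1] and X_T → Y_T → Z_T → X_T[1] are Auslander–Reiten triangles in S and T respectively, with Z_T = F Z_S. Then there exists an object W of S such that the triangle G X_T → G Y_T → G Z_T → G X_T[1] obtained by applying G is isomorphic, as a triangle in S, to the direct sum of the triangle X_S → Y_S → Z_S → X_S[1] and the contractible triangle W →id W → 0 → W[1]. -/

import Mathlib

open CategoryTheory CategoryTheory.Limits CategoryTheory.Pretriangulated

universe v₁ v₂ u₁ u₂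

/-- A map `α : X ⟶ Y` is *left almost split* if `α` is not a section and
every map `X ⟶ Y'` which is not a section factors through `α`. -/
def IsLeftAlmostSplit {C : Type u₁} [Category.{v₁} C] {X Y : C} (α : X ⟶ Y) : Prop :=
  (¬ ∃ r : Y ⟶ X, α ≫ r = 𝟙 X) ∧
    ∀ ⦃Y' : C⦄ (f : X ⟶ Y'), (¬ ∃ r : Y' ⟶ X, f ≫ r = 𝟙 X) → ∃ g : Y ⟶ Y', α ≫ g = f

/-- A map `β : Y ⟶ Z` is *right almost split* if `β` is not a retraction and
every map `Y' ⟶ Z` which is not a retraction factors through `β`. -/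
def IsRightAlmostSplit {C : Type u₁} [Category.{v₁} C] {Y Z : C} (β : Y ⟶ Z) : Prop :=
  (¬ ∃ s : Z ⟶ Y, s ≫ β = 𝟙 Z) ∧
    ∀ ⦃Y' : C⦄ (f : Y' ⟶ Z), (¬ ∃ s : Z ⟶ Y', s ≫ f = 𝟙 Z) → ∃ g : Y' ⟶ Y, g ≫ β = f

/-- A distinguished triangle is an *Auslander–Reiten triangle* if its first map is
left almost split and its second map is right almost split. -/
def IsARTriangle (C : Type u₁) [Category.{v₁} C] [HasZeroObject C] [HasShift C ℤ]
    [Preadditive C] [∀ n : ℤ, (shiftFunctor C n).Additive] [Pretriangulated C]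
    (T : Triangle C) : Prop :=
  (T ∈ distTriang C) ∧ IsLeftAlmostSplit T.mor₁ ∧ IsRightAlmostSplit T.mor₂

/-- The direct sum of two triangles, with componentwise maps. -/
noncomputable def triangleDirectSum (C : Type u₁) [Category.{v₁} C] [Preadditive C]
    [HasBinaryBiproducts C] [HasShift C ℤ] (T₁ T₂ : Triangle C) : Triangle C :=
  Triangle.mk (biprod.map T₁.mor₁ T₂.mor₁) (biprod.map T₁.mor₂ T₂.mor₂)
    (biprod.desc (T₁.mor₃ ≫ (shiftFunctor C (1 : ℤ)).map biprod.inl)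
      (T₂.mor₃ ≫ (shiftFunctor C (1 : ℤ)).map biprod.inr))

section

open scoped ZeroObject

variable {C : Type u₁} [Category.{v₁} C] [HasZeroObject C] [HasShift C ℤ] [Preadditive C]
  [∀ n : ℤ, (shiftFunctor C n).Additive] [Pretriangulated C]

lemma isIso_of_mono_of_epi_of_pretriangulated {X Y : C} (f : X ⟶ Y) [Mono f] [Epi f] :
    IsIso f :=
  have := isSplitEpi_of_epi f
  isIso_of_mono_of_isSplitEpi f

/-- In an Auslander–Reiten triangle, an endomorphism of the first object that fixes the
connecting morphism is a section. -/
lemma IsARTriangle.exists_retraction {A : Triangle C} (hA : IsARTriangle C A)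
    (e : A.obj₁ ⟶ A.obj₁) (he : A.mor₃ ≫ e⟦(1 : ℤ)⟧' = A.mor₃) :
    ∃ r : A.obj₁ ⟶ A.obj₁, e ≫ r = 𝟙 _ := by
  by_contra h
  obtain ⟨k, hk⟩ := hA.2.1.2 e h
  have h₀ : A.mor₃ = 0 := by
    rw [← he, ← hk, Functor.map_comp, ← Category.assoc, comp_distTriang_mor_zero₃₁ _ hA.1,
      zero_comp]
  obtain ⟨s, hs⟩ := A.coyoneda_exact₃ hA.1 (𝟙 _) (by rw [h₀, comp_zero])
  exact hA.2.2.1 ⟨s, hs.symm⟩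

lemma IsARTriangle.isIso_hom₁ {A : Triangle C} (hA : IsARTriangle C A)
    (e : A.obj₁ ⟶ A.obj₁) (he : A.mor₃ ≫ e⟦(1 : ℤ)⟧' = A.mor₃) : IsIso e := by
  obtain ⟨r, hr⟩ := hA.exists_retraction e he
  have hr' : A.mor₃ ≫ r⟦(1 : ℤ)⟧' = A.mor₃ := by
    conv_lhs => rw [← he]
    rw [Category.assoc, ← Functor.map_comp, hr, CategoryTheory.Functor.map_id, Category.comp_id]
  obtain ⟨q, hq⟩ := hA.exists_retraction r hr'
  have : e = q := by
    rw [← Category.comp_id e, ← hq, ← Category.assoc, hr, Category.id_comp]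
  exact ⟨r, hr, by rw [this, hq]⟩

/-- An endomorphism of an Auslander–Reiten triangle which is the identity on the third
object is an isomorphism. -/
lemma IsARTriangle.isIso_of_hom₃_eq_id {A : Triangle C} (hA : IsARTriangle C A) (e : A ⟶ A)
    (he : e.hom₃ = 𝟙 _) : IsIso e := by
  have h₁ : IsIso e.hom₁ := hA.isIso_hom₁ e.hom₁ (by rw [e.comm₃, he, Category.id_comp])
  have h₃ : IsIso e.hom₃ := by rw [he]; infer_instance
  have h₂ : IsIso e.hom₂ := isIso₂_of_isIso₁₃ e hA.1 hA.1 h₁ h₃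
  exact Triangle.isIso_of_isIsos e h₁ h₂ h₃

/-- If a distinguished triangle `A` is a retract of a distinguished triangle `B` and the
inclusion is an isomorphism on third objects, then the complement is contractible. -/
lemma exists_iso_triangleDirectSum_of_retract [HasBinaryBiproducts C] {A B : Triangle C}
    (hA : A ∈ distTriang C) (hB : B ∈ distTriang C) (φ : A ⟶ B) (ψ : B ⟶ A) (h : φ ≫ ψ = 𝟙 A)
    [IsIso φ.hom₃] :
    ∃ W : C, Nonempty (B ≅ triangleDirectSum C A (contractibleTriangle W)) := by
  have h₁ : φ.hom₁ ≫ ψ.hom₁ = 𝟙 _ := congrArg TriangleMorphism.hom₁ h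
  have h₂ : φ.hom₂ ≫ ψ.hom₂ = 𝟙 _ := congrArg TriangleMorphism.hom₂ h
  obtain ⟨W, i, d, hW⟩ := distinguished_cocone_triangle₁ ψ.hom₁
  have hi : i ≫ ψ.hom₁ = 0 := comp_distTriang_mor_zero₁₂ _ hW
  have hepi : Epi ψ.hom₁ := (SplitEpi.mk φ.hom₁ h₁).epi
  have hmono : Mono i := Triangle.mono₁ _ hW (Triangle.mor₃_eq_zero_of_epi₂ _ hW hepi)
  have hB₃ : B.mor₃ = inv φ.hom₃ ≫ A.mor₃ ≫ φ.hom₁⟦(1 : ℤ)⟧' := by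
    rw [φ.comm₃, IsIso.inv_hom_id_assoc]
  have hmono₁ : Mono (biprod.desc φ.hom₁ i) := by
    rw [Preadditive.mono_iff_cancel_zero]
    intro P t ht
    have ht' : (t ≫ biprod.fst) ≫ φ.hom₁ + (t ≫ biprod.snd) ≫ i = 0 := by
      simpa [biprod.desc_eq] using ht
    have hfst : t ≫ biprod.fst = 0 := by
      simpa [h₁, hi] using ht' =≫ ψ.hom₁
    have hsnd : t ≫ biprod.snd = 0 := by
      rw [← cancel_mono i, zero_comp]
      simpa only [hfst, zero_comp, zero_add] using ht'
    ext <;> simp [hfst, hsnd]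
  have hepi₁ : Epi (biprod.desc φ.hom₁ i) := by
    rw [Preadditive.epi_iff_cancel_zero]
    intro P t ht
    have hinl : φ.hom₁ ≫ t = 0 := by simpa using biprod.inl ≫= ht
    have hinr : i ≫ t = 0 := by simpa using biprod.inr ≫= ht
    obtain ⟨s, hs⟩ : ∃ s : A.obj₁ ⟶ P, t = ψ.hom₁ ≫ s := Triangle.yoneda_exact₂ _ hW t hinr
    have : s = 0 := by
      rw [← Category.id_comp s, ← h₁, Category.assoc, ← hs, hinl]
    rw [hs, this, comp_zero]
  have hmono₂ : Mono (biprod.desc φ.hom₂ (i ≫ B.mor₁)) := by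
    rw [Preadditive.mono_iff_cancel_zero]
    intro P t ht
    have ht' : (t ≫ biprod.fst) ≫ φ.hom₂ + (t ≫ biprod.snd) ≫ i ≫ B.mor₁ = 0 := by
      simpa [biprod.desc_eq] using ht
    have hfst : t ≫ biprod.fst = 0 := by
      simpa [h₂, ψ.comm₁, reassoc_of% hi] using ht' =≫ ψ.hom₂
    have hsnd : t ≫ biprod.snd = 0 := by
      rw [hfst, zero_comp, zero_add] at ht'
      obtain ⟨z, hz⟩ := B.coyoneda_exact₁ hB (((t ≫ biprod.snd) ≫ i)⟦(1 : ℤ)⟧')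
        (by rw [← Functor.map_comp, Category.assoc, ht', Functor.map_zero])
      have hz' : z ≫ inv φ.hom₃ ≫ A.mor₃ = 0 := by
        have := hz =≫ ψ.hom₁⟦(1 : ℤ)⟧'
        rw [← Functor.map_comp, Category.assoc, hi, comp_zero, Functor.map_zero, hB₃] at this
        simpa only [Category.assoc, ← Functor.map_comp, h₁, CategoryTheory.Functor.map_id,
          Category.comp_id] using this.symm
      rw [← cancel_mono i, zero_comp]
      apply (shiftFunctor C (1 : ℤ)).map_injective
      rw [Functor.map_zero, hz, hB₃, ← Category.assoc (inv φ.hom₃), ← Category.assoc z, hz',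
        zero_comp]
    ext <;> simp [hfst, hsnd]
  have hepi₂ : Epi (biprod.desc φ.hom₂ (i ≫ B.mor₁)) := by
    rw [Preadditive.epi_iff_cancel_zero]
    intro P t ht
    have hinl : φ.hom₂ ≫ t = 0 := by simpa using biprod.inl ≫= ht
    have hinr : i ≫ B.mor₁ ≫ t = 0 := by simpa using biprod.inr ≫= ht
    have hmor₁ : B.mor₁ ≫ t = 0 := by
      rw [← cancel_epi (biprod.desc φ.hom₁ i)]
      ext
      · rw [biprod.inl_desc_assoc, ← Category.assoc, ← φ.comm₁, Category.assoc, hinl]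
        simp
      · rw [biprod.inr_desc_assoc, hinr]
        simp
    obtain ⟨s, rfl⟩ := B.yoneda_exact₂ hB t hmor₁
    obtain ⟨k, hk⟩ := A.yoneda_exact₃ hA (φ.hom₃ ≫ s) (by
      rw [← Category.assoc, φ.comm₂, Category.assoc, hinl])
    have hs : s = B.mor₃ ≫ ψ.hom₁⟦(1 : ℤ)⟧' ≫ k := by
      rw [← cancel_epi φ.hom₃, hk, ← Category.assoc, ← φ.comm₃, Category.assoc,
        ← Category.assoc (φ.hom₁⟦(1 : ℤ)⟧'), ← Functor.map_comp, h₁, CategoryTheory.Functor.map_id,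
        Category.id_comp]
    rw [hs, ← Category.assoc, comp_distTriang_mor_zero₂₃ _ hB, zero_comp]
  have hiso₁ := isIso_of_mono_of_epi_of_pretriangulated (biprod.desc φ.hom₁ i)
  have hiso₂ := isIso_of_mono_of_epi_of_pretriangulated (biprod.desc φ.hom₂ (i ≫ B.mor₁))
  have hiso₃ : IsIso (biprod.desc φ.hom₃ (0 : (0 : C) ⟶ B.obj₃)) :=
    ⟨inv φ.hom₃ ≫ biprod.inl, by ext; simp, by simp⟩
  let e₁ := asIso (biprod.desc φ.hom₁ i)
  let e₂ := asIso (biprod.desc φ.hom₂ (i ≫ B.mor₁))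
  let e₃ := asIso (biprod.desc φ.hom₃ (0 : (0 : C) ⟶ B.obj₃))
  refine ⟨W, ⟨(Triangle.isoMk (triangleDirectSum C A (contractibleTriangle W)) B
    e₁ e₂ e₃ ?_ ?_ ?_).symm⟩⟩
  · change biprod.map A.mor₁ (𝟙 W) ≫ biprod.desc φ.hom₂ (i ≫ B.mor₁) =
      biprod.desc φ.hom₁ i ≫ B.mor₁
    ext <;> simp
  · change biprod.map A.mor₂ (0 : W ⟶ 0) ≫ biprod.desc φ.hom₃ (0 : (0 : C) ⟶ B.obj₃) =
      biprod.desc φ.hom₂ (i ≫ B.mor₁) ≫ B.mor₂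
    ext
    · simp
    · simp [comp_distTriang_mor_zero₁₂ _ hB]
  · change biprod.desc (A.mor₃ ≫ (shiftFunctor C (1 : ℤ)).map biprod.inl)
        ((0 : (0 : C) ⟶ W⟦(1 : ℤ)⟧) ≫ (shiftFunctor C (1 : ℤ)).map biprod.inr) ≫
        (biprod.desc φ.hom₁ i)⟦(1 : ℤ)⟧' =
      biprod.desc φ.hom₃ (0 : (0 : C) ⟶ B.obj₃) ≫ B.mor₃
    ext
    simp [← Functor.map_comp]

/-- Maps in both directions between the middle objects of an Auslander–Reiten triangle `A` and
a distinguished triangle `B`, compatible with an isomorphism of the third objects, exhibit `B`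
as the direct sum of `A` and a contractible triangle. -/
lemma IsARTriangle.exists_iso_triangleDirectSum [HasBinaryBiproducts C] {A B : Triangle C}
    (hA : IsARTriangle C A) (hB : B ∈ distTriang C) (e : A.obj₃ ≅ B.obj₃)
    (a : A.obj₂ ⟶ B.obj₂) (ha : A.mor₂ ≫ e.hom = a ≫ B.mor₂)
    (b : B.obj₂ ⟶ A.obj₂) (hb : B.mor₂ ≫ e.inv = b ≫ A.mor₂) :
    ∃ W : C, Nonempty (B ≅ triangleDirectSum C A (contractibleTriangle W)) := by
  obtain ⟨u, hu₁, hu₃⟩ := complete_distinguished_triangle_morphism₁ A B hA.1 hB a e.hom ha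
  obtain ⟨v, hv₁, hv₃⟩ := complete_distinguished_triangle_morphism₁ B A hB hA.1 b e.inv hb
  let φ : A ⟶ B := { hom₁ := u, hom₂ := a, hom₃ := e.hom, comm₁ := hu₁, comm₂ := ha, comm₃ := hu₃ }
  let ψ : B ⟶ A := { hom₁ := v, hom₂ := b, hom₃ := e.inv, comm₁ := hv₁, comm₂ := hb, comm₃ := hv₃ }
  have : IsIso (φ ≫ ψ) := hA.isIso_of_hom₃_eq_id _ e.hom_inv_id
  have : IsIso φ.hom₃ := inferInstanceAs (IsIso e.hom)
  exact exists_iso_triangleDirectSum_of_retract hA.1 hB φ (ψ ≫ inv (φ ≫ ψ))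
    (by rw [← Category.assoc, IsIso.hom_inv_id])

end

/-- if `F : S ⥤ T` is a fully faithful exact functor between triangulated
categories with an exact right adjoint `G`, and if `X_S → Y_S → Z_S → X_S[1]` and
`X_T → Y_T → Z_T → X_T[1]` are Auslander–Reiten triangles in `S` and `T` with
`Z_T = F Z_S`, then the triangle obtained by applying `G` to the second triangle is
isomorphic to the direct sum of the first triangle and a contractible triangle
`W → W → 0 → W[1]`. -/
theorem stmt_13 {S : Type u₁} {T : Type u₂} [Category.{v₁} S] [Category.{v₂} T]
    [HasZeroObject S] [HasZeroObject T] [Preadditive S] [Preadditive T]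
    [HasShift S ℤ] [HasShift T ℤ]
    [∀ n : ℤ, (shiftFunctor S n).Additive] [∀ n : ℤ, (shiftFunctor T n).Additive]
    [Pretriangulated S] [Pretriangulated T] [HasBinaryBiproducts S]
    (F : S ⥤ T) (G : T ⥤ S) [F.CommShift ℤ] [G.CommShift ℤ]
    [F.IsTriangulated] [G.IsTriangulated] [F.Full] [F.Faithful]
    (adj : F ⊣ G)
    (T₁ : Triangle S) (T₂ : Triangle T)
    (hT₁ : IsARTriangle S T₁) (hT₂ : IsARTriangle T T₂)
    (hZ : T₂.obj₃ = F.obj T₁.obj₃) :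
    ∃ W : S, Nonempty (G.mapTriangle.obj T₂ ≅ triangleDirectSum S T₁ (contractibleTriangle W)) := by
  obtain ⟨X, Y, Z, f, g, h⟩ := T₂
  obtain rfl : Z = F.obj T₁.obj₃ := hZ
  have hg := hT₂.2.2
  change IsRightAlmostSplit g at hg
  obtain ⟨a, ha⟩ : ∃ a : F.obj T₁.obj₂ ⟶ Y, a ≫ g = F.map T₁.mor₂ := by
    refine hg.2 _ ?_
    rintro ⟨s, hs⟩
    exact hT₁.2.2.1 ⟨F.preimage s, F.map_injective (by simpa using hs)⟩
  obtain ⟨b, hb⟩ : ∃ b : G.obj Y ⟶ T₁.obj₂,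
      b ≫ T₁.mor₂ = G.map g ≫ inv (adj.unit.app T₁.obj₃) := by
    refine hT₁.2.2.2 _ ?_
    rintro ⟨s, hs⟩
    have hs' : s ≫ G.map g = adj.unit.app T₁.obj₃ := by
      simpa using hs =≫ adj.unit.app T₁.obj₃
    refine hg.1 ⟨(adj.homEquiv _ _).symm s, ?_⟩
    rw [← Adjunction.homEquiv_naturality_right_symm, hs', Equiv.symm_apply_eq,
      Adjunction.homEquiv_id]
  let e : T₁.obj₃ ≅ G.obj (F.obj T₁.obj₃) := asIso (adj.unit.app T₁.obj₃)
  refine hT₁.exists_iso_triangleDirectSum (G.map_distinguished _ hT₂.1)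
    e (adj.homEquiv _ _ a) ?_ b hb.symm
  change T₁.mor₂ ≫ adj.unit.app T₁.obj₃ = adj.homEquiv _ _ a ≫ G.map g
  rw [← Adjunction.homEquiv_naturality_right, ha, Adjunction.homEquiv_unit]
  exact adj.unit.naturality T₁.mor₂
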